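/- There is a universal constant c > 0 such that: if K ⊂ ℝⁿ is a p-convex body with constant α and volume 1, then for every function f : K → ℝ that is 1-Lipschitz with respect to the Euclidean norm and every t > 0, vol{x ∈ K : |f(x) − ∫_K f(y) dy| ≥ diam(K) · t} ≤ 4 exp(−2 c^p α n t^p). -/

import Mathlib

open MeasureTheory Real Set
open scoped ENNReal RealInnerProductSpace Pointwise

noncomputable section

namespace GM

abbrev E (n : ℕ) := EuclideanSpace ℝ (Fin n)

variable {n : ℕ}

/-- A centrally-symmetric convex body. -/
def IsConvexBody (K : Set (E n)) : Prop :=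
  IsCompact K ∧ Convex ℝ K ∧ (interior K).Nonempty ∧ K = -K

/-- The Euclidean unit sphere in `E n`. -/
def usphere (n : ℕ) : Set (E n) := Metric.sphere 0 1

/-- Haar probability measure on the unit sphere, realized as the normalized
`(n-1)`-dimensional Hausdorff measure restricted to the sphere. -/
def sphMeasure (n : ℕ) : Measure (E n) :=
  (μH[(n : ℝ) - 1] (usphere n))⁻¹ • (μH[(n : ℝ) - 1]).restrict (usphere n)

/-- The marginal density `g_θ(s) = vol_{n-1}(K ∩ {sθ + θ^⊥})`. -/
def gdens (K : Set (E n)) (θ : E n) (s : ℝ) : ℝ :=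
  (μH[(n : ℝ) - 1] (K ∩ {x : E n | ⟪x, θ⟫ = s})).toReal

/-- The centered Gaussian density with variance `ρ²`. -/
def gauss (ρ s : ℝ) : ℝ :=
  (Real.sqrt (2 * π) * ρ)⁻¹ * Real.exp (-(s ^ 2) / (2 * ρ ^ 2))

/-- Kolmogorov-type distance between even densities. -/
def dKol (f₁ f₂ : ℝ → ℝ) : ℝ :=
  sSup {d | ∃ t > (0 : ℝ), d = |(∫ s in (-t)..t, f₁ s) - ∫ s in (-t)..t, f₂ s|}

/-- Linnik-type distance between densities. -/
def dLin (T : ℝ) (f₁ f₂ : ℝ → ℝ) : ℝ :=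
  sSup {d | ∃ s : ℝ, 0 ≤ s ∧ s ≤ T ∧ d = |f₁ s / f₂ s - 1|}

/-- `ρ_θ = (∫_K ⟨x,θ⟩² dx)^{1/2}`. -/
def rhoDir (K : Set (E n)) (θ : E n) : ℝ :=
  Real.sqrt (∫ x in K, ⟪x, θ⟫ ^ 2)

def rhoMax (K : Set (E n)) : ℝ := sSup (rhoDir K '' usphere n)

def rhoAvg (K : Set (E n)) : ℝ := ∫ θ, rhoDir K θ ∂(sphMeasure n)

/-- `C_iso(K) = ρ_max / ρ_avg`. -/
def Ciso (K : Set (E n)) : ℝ := rhoMax K / rhoAvg K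

/-- Concentration hypothesis (⋆) with parameters `(ρ, A, B, ν, τ)`. -/
def ConcHyp (K : Set (E n)) (ρ A B ν τ : ℝ) : Prop :=
  ∀ t : ℝ, 0 ≤ t → t ≤ 1 →
    volume {x : E n | x ∈ K ∧ t * ρ ≤ |‖x‖ / Real.sqrt n - ρ|} ≤
      ENNReal.ofReal (A * Real.exp (-B * (n : ℝ) ^ ν * t ^ τ))

/-- The modulus of convexity of `K` (w.r.t. the gauge norm of `K`). -/
def modConv (K : Set (E n)) (ε : ℝ) : ℝ :=
  sInf {d | ∃ x y : E n, gauge K x ≤ 1 ∧ gauge K y ≤ 1 ∧ ε ≤ gauge K (x - y) ∧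
    d = 1 - gauge K ((2⁻¹ : ℝ) • (x + y))}

/-- `K` is a `p`-convex body with constant `α`. -/
def IsPConvexBody (K : Set (E n)) (p α : ℝ) : Prop :=
  IsConvexBody K ∧ ∀ ε : ℝ, 0 < ε → ε ≤ 2 → α * ε ^ p ≤ modConv K ε

/-- Löwner's minimal diameter position. -/
def IsLowner (K : Set (E n)) : Prop :=
  ∀ T : E n →ₗ[ℝ] E n, |LinearMap.det T| = 1 →
    Metric.diam K ≤ Metric.diam (T '' K)

/-- The type-`s` constant of `X_K = (ℝⁿ, ‖·‖_K)`. -/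
def typeConst (K : Set (E n)) (s : ℝ) : ℝ :=
  sInf {T : ℝ | 0 < T ∧ ∀ m : ℕ, ∀ x : Fin m → E n,
    Real.sqrt (((2 : ℝ) ^ m)⁻¹ * ∑ ε : Fin m → Bool,
      gauge K (∑ i, (if ε i then (1 : ℝ) else -1) • x i) ^ 2) ≤
      T * (∑ i, gauge K (x i) ^ s) ^ (1 / s)}

/-- `X_K` is (isometric to) a subspace of a quotient of `L_p([0,1])`:
there is a closed submodule `N` of `L_p([0,1])` and a linear isometric embedding of
`(ℝⁿ, ‖·‖_K)` into the quotient `L_p([0,1]) ⧸ N` (with the quotient norm). -/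
def IsSubspaceOfQuotientOfLp (K : Set (E n)) (p : ℝ) (hp : 1 ≤ p) : Prop :=
  letI : Fact ((1 : ℝ≥0∞) ≤ ENNReal.ofReal p) := ⟨ENNReal.one_le_ofReal.mpr hp⟩
  ∃ N : Submodule ℝ (MeasureTheory.Lp ℝ (ENNReal.ofReal p) (volume.restrict (Icc (0 : ℝ) 1))),
    IsClosed (N : Set (MeasureTheory.Lp ℝ (ENNReal.ofReal p) (volume.restrict (Icc (0 : ℝ) 1)))) ∧
    ∃ J : E n →ₗ[ℝ]
      (MeasureTheory.Lp ℝ (ENNReal.ofReal p) (volume.restrict (Icc (0 : ℝ) 1)) ⧸ N),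
      ∀ x : E n, gauge K x = ‖J x‖

/-- `K` is isotropic with isotropic constant `L`. -/
def IsIsotropic (K : Set (E n)) (L : ℝ) : Prop :=
  volume K = 1 ∧ ∀ θ : E n, ‖θ‖ = 1 → (∫ x in K, ⟪x, θ⟫ ^ 2) = L ^ 2

/-- Entropy of `g` over `K`. -/
def entK (K : Set (E n)) (g : E n → ℝ) : ℝ :=
  (∫ x in K, g x * Real.log (g x)) - (∫ x in K, g x) * Real.log (∫ x in K, g x)

/-- `Var^q_K(f) = ∫_K |f - ∫_K f|^q`. -/
def varq (K : Set (E n)) (q : ℝ) (f : E n → ℝ) : ℝ :=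
  ∫ x in K, |f x - ∫ y in K, f y| ^ q

/-- The dual gauge `‖y‖_K^* = sup_{x ∈ K} ⟨x,y⟩`. -/
def dualGauge (K : Set (E n)) (y : E n) : ℝ :=
  sSup ((fun x : E n => ⟪x, y⟫) '' K)

/-- Half the mean width `M*(K)`. -/
def Mstar (K : Set (E n)) : ℝ := ∫ θ, dualGauge K θ ∂(sphMeasure n)

/-- Minimal mean-width position. -/
def IsMinMeanWidth (K : Set (E n)) : Prop :=
  ∀ T : E n →ₗ[ℝ] E n, |LinearMap.det T| = 1 → Mstar K ≤ Mstar (T '' K)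

/-- Positive definite symmetric linear map. -/
def IsPosDef (T : E n →ₗ[ℝ] E n) : Prop :=
  LinearMap.IsSymmetric T ∧ ∀ x : E n, x ≠ 0 → 0 < ⟪T x, x⟫

/-- Operator norm (w.r.t. the Euclidean norm). -/
def opNorm (T : E n →ₗ[ℝ] E n) : ℝ := ‖LinearMap.toContinuousLinearMap T‖

theorem bm1_compact {A B C : Set ℝ} (hA : IsCompact A) (hB : IsCompact B) (hAn : A.Nonempty)
    (hBn : B.Nonempty) (h : ∀ a ∈ A, ∀ b ∈ B, (2⁻¹ : ℝ) • (a + b) ∈ C) :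
    volume A + volume B ≤ 2 * volume C := by
  obtain ⟨a, haA, ha⟩ := hA.exists_isGreatest hAn
  obtain ⟨b, hbB, hb⟩ := hB.exists_isLeast hBn
  set D : Set ℝ := (fun x => 2⁻¹ * x) ⁻¹' C with hD
  have hDv : volume D = 2 * volume C := by
    rw [hD, Real.volume_preimage_mul_left (by norm_num)]
    norm_num
  rw [← hDv, ← measure_inter_add_sdiff D (measurableSet_Iic (a := a + b))]
  refine add_le_add ?_ ?_
  · rw [← measure_preimage_add_right volume b (D ∩ Iic (a + b))]
    refine measure_mono fun x hx => ⟨?_, ?_⟩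
    · have := h x hx b hbB
      simpa [hD] using this
    · have := ha hx
      simpa using this
  · have h0 : volume B = volume (B \ {b}) := (measure_sdiff_null (by simp)).symm
    rw [h0, ← measure_preimage_add volume a (D \ Iic (a + b))]
    refine measure_mono fun x hx => ⟨?_, ?_⟩
    · have := h a haA x hx.1
      simpa [hD] using this
    · have h1 := hb hx.1
      have h2 : x ≠ b := hx.2
      have : b < x := lt_of_le_of_ne h1 h2.symm
      simpa using this

theorem bm1 {A B C : Set ℝ} (hA : MeasurableSet A) (hB : MeasurableSet B) (hAn : A.Nonempty)
    (hBn : B.Nonempty) (h : ∀ a ∈ A, ∀ b ∈ B, (2⁻¹ : ℝ) • (a + b) ∈ C) :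
    volume A + volume B ≤ 2 * volume C := by
  rw [hA.measure_eq_iSup_isCompact, hB.measure_eq_iSup_isCompact]
  obtain ⟨a, ha⟩ := hAn
  obtain ⟨b, hb⟩ := hBn
  simp only [iSup_and']
  refine ENNReal.biSup_add_biSup_le' ⟨∅, by simp⟩ ⟨∅, by simp⟩ ?_
  rintro K ⟨hK, hK'⟩ L ⟨hL, hL'⟩
  refine le_trans (add_le_add (measure_mono (subset_insert a K)) (measure_mono (subset_insert b L))) ?_
  refine bm1_compact (hK'.insert a) (hL'.insert b) ⟨a, by simp⟩ ⟨b, by simp⟩ ?_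
  exact fun x hx y hy => h x (insert_subset ha hK hx) y (insert_subset hb hL hy)

theorem pl1_norm {f g h : ℝ → ℝ} (hf : Measurable f) (hg : Measurable g) (hh : Measurable h)
    (hf0 : ∀ x, 0 ≤ f x) (hg0 : ∀ x, 0 ≤ g x) (hh0 : ∀ x, 0 ≤ h x)
    (hf1 : ∀ x, f x ≤ 1) (hg1 : ∀ x, g x ≤ 1)
    (hfs : ∀ t < 1, ∃ x, t < f x) (hgs : ∀ t < 1, ∃ x, t < g x)
    (H : ∀ x y, f x * g y ≤ h ((2⁻¹ : ℝ) • (x + y)) ^ 2) :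
    (∫⁻ x, ENNReal.ofReal (f x)) + ∫⁻ x, ENNReal.ofReal (g x) ≤ 2 * ∫⁻ x, ENNReal.ofReal (h x) := by
  rw [lintegral_eq_lintegral_meas_lt volume (.of_forall hf0) hf.aemeasurable,
    lintegral_eq_lintegral_meas_lt volume (.of_forall hg0) hg.aemeasurable,
    lintegral_eq_lintegral_meas_lt volume (.of_forall hh0) hh.aemeasurable]
  have hanti : Antitone fun t : ℝ => volume {x | t < f x} := fun s t hst =>
    measure_mono fun x hx => lt_of_le_of_lt hst hx
  rw [← lintegral_add_left hanti.measurable, ← lintegral_const_mul' _ _ (by norm_num)]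
  refine setLIntegral_mono' measurableSet_Ioi fun t ht => ?_
  have ht0 : 0 < t := ht
  rcases lt_or_ge t 1 with h1 | h1
  · refine bm1 (measurableSet_lt measurable_const hf) (measurableSet_lt measurable_const hg)
      (hfs t h1) (hgs t h1) fun a ha b hb => ?_
    have ha' : t < f a := ha
    have hb' : t < g b := hb
    have := H a b
    have h2 : t ^ 2 < h ((2⁻¹ : ℝ) • (a + b)) ^ 2 := by nlinarith
    exact lt_of_pow_lt_pow_left₀ 2 (hh0 _) h2
  · have e1 : {x | t < f x} = ∅ := by
      ext x; simpa using (hf1 x).trans h1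
    have e2 : {x | t < g x} = ∅ := by
      ext x; simpa using (hg1 x).trans h1
    simp [e1, e2]

theorem amgm_ennreal (a b c : ℝ≥0∞) (h : a + b ≤ 2 * c) : a * b ≤ c ^ 2 := by
  rcases eq_or_ne c ⊤ with rfl | hc
  · simp
  have hab : a + b ≠ ⊤ := ne_top_of_le_ne_top (ENNReal.mul_ne_top (by norm_num) hc) h
  have ha : a ≠ ⊤ := fun h => hab (by simp [h])
  have hb : b ≠ ⊤ := fun h => hab (by simp [h])
  lift a to NNReal using ha
  lift b to NNReal using hb
  lift c to NNReal using hc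
  norm_cast at h ⊢
  have h' : (a : ℝ) + b ≤ 2 * c := by exact_mod_cast h
  have : (a : ℝ) * b ≤ c ^ 2 := by
    nlinarith [sq_nonneg ((a : ℝ) - b), a.coe_nonneg, b.coe_nonneg, c.coe_nonneg]
  exact_mod_cast this

theorem pl1_bdd {f g h : ℝ → ℝ≥0∞} (hf : Measurable f) (hg : Measurable g) (hh : Measurable h)
    (N : ℕ) (hfN : ∀ x, f x ≤ N) (hgN : ∀ x, g x ≤ N)
    (H : ∀ x y, f x * g y ≤ h ((2⁻¹ : ℝ) • (x + y)) ^ 2) :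
    (∫⁻ x, f x) * ∫⁻ x, g x ≤ (∫⁻ x, h x) ^ 2 := by
  set F := ⨆ x, f x with hF
  set G := ⨆ x, g x with hG
  have hFf : ∀ x, f x ≤ F := fun x => le_iSup f x
  have hGg : ∀ x, g x ≤ G := fun x => le_iSup g x
  rcases eq_or_ne F 0 with hF0 | hF0
  · have : ∀ x, f x = 0 := fun x => le_antisymm (hF0 ▸ hFf x) (zero_le)
    simp [this]
  rcases eq_or_ne G 0 with hG0 | hG0
  · have : ∀ x, g x = 0 := fun x => le_antisymm (hG0 ▸ hGg x) (zero_le)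
    simp [this]
  have hFt : F ≠ ⊤ := ne_top_of_le_ne_top (ENNReal.natCast_ne_top N) (iSup_le hfN)
  have hGt : G ≠ ⊤ := ne_top_of_le_ne_top (ENNReal.natCast_ne_top N) (iSup_le hgN)
  set s : ℝ≥0∞ := ENNReal.ofReal (√(F.toReal * G.toReal)) with hs
  have hs2 : s ^ 2 = F * G := by
    rw [hs, ← ENNReal.ofReal_pow (by positivity), Real.sq_sqrt (by positivity),
      ENNReal.ofReal_mul (by positivity), ENNReal.ofReal_toReal hFt, ENNReal.ofReal_toReal hGt]
  have hst : s ≠ ⊤ := ENNReal.ofReal_ne_top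
  have hs0 : s ≠ 0 := by
    intro h0
    rw [h0] at hs2
    simp at hs2
    tauto
  have hfF1 : ∀ x, f x / F ≤ 1 := fun x => ENNReal.div_le_of_le_mul (by simpa using hFf x)
  have hgG1 : ∀ x, g x / G ≤ 1 := fun x => ENNReal.div_le_of_le_mul (by simpa using hGg x)
  have key : (∫⁻ x, ENNReal.ofReal (f x / F).toReal) + ∫⁻ x, ENNReal.ofReal (g x / G).toReal
      ≤ 2 * ∫⁻ x, ENNReal.ofReal (min (h x / s) 1).toReal := by
    have sup : ∀ (u : ℝ → ℝ≥0∞), (⨆ x, u x) ≠ 0 → (⨆ x, u x) ≠ ⊤ → (∀ x, u x / (⨆ x, u x) ≤ 1) →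
        ∀ t < (1:ℝ), ∃ x, t < (u x / (⨆ x, u x)).toReal := by
      intro u h0 ht h1 t ht1
      have : (⨆ x, u x) * ENNReal.ofReal t < ⨆ x, u x := by
        conv_rhs => rw [← mul_one (⨆ x, u x)]
        exact ENNReal.mul_lt_mul_right h0 ht (by simpa using ht1)
      obtain ⟨x, hx⟩ := lt_iSup_iff.1 this
      refine ⟨x, ?_⟩
      rw [mul_comm, ← ENNReal.lt_div_iff_mul_lt (.inl h0) (.inl ht)] at hx
      by_contra hcon
      refine absurd hx (not_lt.2 ?_)
      rw [← ENNReal.ofReal_toReal (ne_top_of_le_ne_top ENNReal.one_ne_top (h1 x))]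
      exact ENNReal.ofReal_le_ofReal (not_lt.1 hcon)
    refine pl1_norm (hf.div_const F).ennreal_toReal (hg.div_const G).ennreal_toReal
      ((hh.div_const s).min measurable_const).ennreal_toReal (fun _ => ENNReal.toReal_nonneg)
      (fun _ => ENNReal.toReal_nonneg) (fun _ => ENNReal.toReal_nonneg)
      (fun x => ENNReal.toReal_le_of_le_ofReal zero_le_one (by simpa using hfF1 x))
      (fun x => ENNReal.toReal_le_of_le_ofReal zero_le_one (by simpa using hgG1 x))
      (sup f hF0 hFt hfF1) (sup g hG0 hGt hgG1) ?_
    intro x y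
    rw [← ENNReal.toReal_mul, ← ENNReal.toReal_pow]
    refine ENNReal.toReal_mono (by simp) ?_
    have : (f x / F) * (g y / G) ≤ (h ((2⁻¹ : ℝ) • (x + y)) / s) ^ 2 := by
      have e1 : (f x / F) * (g y / G) = (f x * g y) / (F * G) := by
        rw [div_eq_mul_inv, div_eq_mul_inv, div_eq_mul_inv, ENNReal.mul_inv (.inl hF0) (.inl hFt)]
        ring
      have e2 : (h ((2⁻¹ : ℝ) • (x + y)) / s) ^ 2 = h ((2⁻¹ : ℝ) • (x + y)) ^ 2 / (F * G) := by
        rw [← hs2, div_eq_mul_inv, div_eq_mul_inv, mul_pow, ENNReal.inv_pow]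
      rw [e1, e2]
      exact ENNReal.div_le_div_right (H x y) _
    rcases le_total (h ((2⁻¹ : ℝ) • (x + y)) / s) 1 with h1 | h1
    · rw [min_eq_left h1]; exact this
    · rw [min_eq_right h1, one_pow]
      exact mul_le_one' (hfF1 x) (hgG1 y)
  have k2 := amgm_ennreal _ _ _ key
  have ef : ∫⁻ x, f x = F * ∫⁻ x, ENNReal.ofReal (f x / F).toReal := by
    rw [← lintegral_const_mul' _ _ hFt]
    refine lintegral_congr fun x => ?_
    rw [ENNReal.ofReal_toReal (ne_top_of_le_ne_top ENNReal.one_ne_top (hfF1 x)),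
      ENNReal.mul_div_cancel hF0 hFt]
  have eg : ∫⁻ x, g x = G * ∫⁻ x, ENNReal.ofReal (g x / G).toReal := by
    rw [← lintegral_const_mul' _ _ hGt]
    refine lintegral_congr fun x => ?_
    rw [ENNReal.ofReal_toReal (ne_top_of_le_ne_top ENNReal.one_ne_top (hgG1 x)),
      ENNReal.mul_div_cancel hG0 hGt]
  have eh : s * ∫⁻ x, ENNReal.ofReal (min (h x / s) 1).toReal ≤ ∫⁻ x, h x := by
    rw [← lintegral_const_mul' _ _ hst]
    refine lintegral_mono fun x => ?_
    rw [ENNReal.ofReal_toReal (by simp)]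
    calc s * min (h x / s) 1 ≤ s * (h x / s) := by gcongr; exact min_le_left _ _
      _ = h x := ENNReal.mul_div_cancel hs0 hst
  calc (∫⁻ x, f x) * ∫⁻ x, g x
      = s ^ 2 * ((∫⁻ x, ENNReal.ofReal (f x / F).toReal) *
          ∫⁻ x, ENNReal.ofReal (g x / G).toReal) := by rw [ef, eg, hs2]; ring
    _ ≤ s ^ 2 * (∫⁻ x, ENNReal.ofReal (min (h x / s) 1).toReal) ^ 2 := by gcongr
    _ = (s * ∫⁻ x, ENNReal.ofReal (min (h x / s) 1).toReal) ^ 2 := by ring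
    _ ≤ _ := by gcongr

/-- The midpoint Prekopa-Leindler property of a measure space with a vector space structure. -/
def PLprop (X : Type) [AddCommGroup X] [Module ℝ X] [MeasureSpace X] : Prop :=
  ∀ f g h : X → ℝ≥0∞, Measurable f → Measurable g → Measurable h →
    (∀ x y, f x * g y ≤ h ((2⁻¹ : ℝ) • (x + y)) ^ 2) →
    (∫⁻ x, f x) * ∫⁻ x, g x ≤ (∫⁻ x, h x) ^ 2

theorem PLprop_real : PLprop ℝ := by
  intro f g h hf hg hh H
  have sup : ∀ u : ℝ → ℝ≥0∞, Measurable u →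
      ∫⁻ x, u x = ⨆ N : ℕ, ∫⁻ x, min (u x) N := by
    intro u hu
    rw [← lintegral_iSup (fun N => hu.min measurable_const)]
    · refine lintegral_congr fun x => ?_
      refine le_antisymm ?_ (iSup_le fun _ => min_le_left _ _)
      rcases eq_or_ne (u x) ⊤ with h | h
      · simp [h, ENNReal.iSup_natCast]
      · obtain ⟨N, hN⟩ := ENNReal.exists_nat_gt h
        exact le_iSup_of_le N (le_min le_rfl hN.le)
    · intro a b hab x
      exact min_le_min le_rfl (by exact_mod_cast hab)
  rw [sup f hf, sup g hg]
  rw [ENNReal.iSup_mul]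
  refine iSup_le fun N => ?_
  rw [ENNReal.mul_iSup]
  refine iSup_le fun M => ?_
  refine le_trans (mul_le_mul' (lintegral_mono (g := fun x => min (f x) ((max N M : ℕ) : ℝ≥0∞)) ?_)
    (lintegral_mono (g := fun x => min (g x) ((max N M : ℕ) : ℝ≥0∞)) ?_)) 
    (pl1_bdd (hf.min measurable_const) (hg.min measurable_const) hh (max N M)
      (fun _ => min_le_right _ _) (fun _ => min_le_right _ _) ?_)
  · intro x; exact min_le_min le_rfl (by exact_mod_cast le_max_left _ _)
  · intro x; exact min_le_min le_rfl (by exact_mod_cast le_max_right _ _)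
  · exact fun x y => le_trans (mul_le_mul' (min_le_left _ _) (min_le_left _ _)) (H x y)

theorem PLprop_prod {X Y : Type} [AddCommGroup X] [Module ℝ X] [MeasureSpace X]
    [AddCommGroup Y] [Module ℝ Y] [MeasureSpace Y] [SFinite (volume : Measure X)]
    [SFinite (volume : Measure Y)] (hX : PLprop X) (hY : PLprop Y) : PLprop (X × Y) := by
  intro f g h hf hg hh H
  have e : ∀ u : X × Y → ℝ≥0∞, Measurable u → ∫⁻ z, u z = ∫⁻ x, ∫⁻ y, u (x, y) := by
    intro u hu
    rw [Measure.volume_eq_prod, lintegral_prod _ hu.aemeasurable]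
  rw [e f hf, e g hg, e h hh]
  refine hX _ _ _ hf.lintegral_prod_right' hg.lintegral_prod_right' hh.lintegral_prod_right' ?_
  intro x x'
  refine hY _ _ _ (hf.comp measurable_prodMk_left) (hg.comp measurable_prodMk_left)
    (hh.comp measurable_prodMk_left) ?_
  intro y y'
  exact H (x, y) (x', y')

theorem PLprop_map {X Y : Type} [AddCommGroup X] [Module ℝ X] [MeasureSpace X]
    [AddCommGroup Y] [Module ℝ Y] [MeasureSpace Y] (hX : PLprop X) (e : X → Y)
    (he : MeasurePreserving e)
    (hlin : ∀ x y, e ((2⁻¹ : ℝ) • (x + y)) = (2⁻¹ : ℝ) • (e x + e y)) : PLprop Y := by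
  intro f g h hf hg hh H
  rw [← he.lintegral_comp hf, ← he.lintegral_comp hg, ← he.lintegral_comp hh]
  refine hX _ _ _ (hf.comp he.measurable) (hg.comp he.measurable) (hh.comp he.measurable) ?_
  intro x y
  simpa only [Function.comp, hlin] using H (e x) (e y)

theorem PLprop_pi : ∀ n : ℕ, PLprop (Fin n → ℝ)
  | 0 => by
    intro f g h hf hg hh H
    have := H default default
    have e : (2⁻¹ : ℝ) • ((default : Fin 0 → ℝ) + default) = default := Subsingleton.elim _ _
    rw [e] at this
    simp only [lintegral_unique]
    have m : volume (univ : Set (Fin 0 → ℝ)) = 1 := by simp [volume_pi]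
    rw [m, mul_one, mul_one, mul_one]
    convert this
  | n + 1 => by
    refine PLprop_map (PLprop_prod PLprop_real (PLprop_pi n))
      (MeasurableEquiv.piFinSuccAbove (fun _ : Fin (n + 1) => ℝ) 0).symm
      (volume_preserving_piFinSuccAbove (fun _ : Fin (n + 1) => ℝ) 0).symm ?_
    intro x y
    ext i
    refine Fin.cases ?_ (fun j => ?_) i <;> simp [MeasurableEquiv.piFinSuccAbove, mul_add]

theorem PLprop_E (n : ℕ) : PLprop (EuclideanSpace ℝ (Fin n)) :=
  PLprop_map (PLprop_pi n) _ (PiLp.volume_preserving_toLp (Fin n)) (fun _ _ => rfl)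

theorem bm_set {n : ℕ} {A B C : Set (EuclideanSpace ℝ (Fin n))} (hA : MeasurableSet A)
    (hB : MeasurableSet B) (hC : MeasurableSet C)
    (h : ∀ a ∈ A, ∀ b ∈ B, (2⁻¹ : ℝ) • (a + b) ∈ C) :
    volume A * volume B ≤ volume C ^ 2 := by
  have := PLprop_E n (A.indicator 1) (B.indicator 1) (C.indicator 1)
    (measurable_one.indicator hA) (measurable_one.indicator hB) (measurable_one.indicator hC) ?_
  · simpa [lintegral_indicator_one, hA, hB, hC] using this
  · intro x y
    by_cases hx : x ∈ A <;> by_cases hy : y ∈ B <;> simp [hx, hy]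
    have := h x hx y hy
    rw [smul_add] at this
    simp [this]

theorem body_zero_nhds {K : Set (E n)} (hK : IsConvexBody K) : K ∈ nhds (0 : E n) := by
  obtain ⟨-, hc, ⟨x, hx⟩, hs⟩ := hK
  have hx' : -x ∈ interior K := by
    have h1 : interior K = -interior K := by
      conv_lhs => rw [hs]
      have := (Homeomorph.neg (E n)).preimage_interior K
      simpa using this.symm
    rw [h1]
    simpa using hx
  have := hc.interior hx hx' (a := 2⁻¹) (b := 2⁻¹) (by norm_num) (by norm_num) (by norm_num)
  simp at this
  exact mem_interior_iff_mem_nhds.1 this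

theorem body_neg_mem {K : Set (E n)} (hK : IsConvexBody K) {x : E n} (hx : x ∈ K) : -x ∈ K := by
  have := hK.2.2.2
  rw [this]; simpa using hx

theorem gauge_abs_smul {K : Set (E n)} (hK : IsConvexBody K) (r : ℝ) (x : E n) :
    gauge K (r • x) = |r| * gauge K x := by
  have := gauge_smul_of_nonneg (abs_nonneg r) (s := K) x
  rcases abs_cases r with ⟨h, -⟩ | ⟨h, -⟩
  · rw [h] at this ⊢; simpa using this
  · rw [h] at this ⊢
    rw [← gauge_neg (fun x hx => body_neg_mem hK hx), ← neg_smul]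
    simpa using this

theorem modConv_le {K : Set (E n)} {ε : ℝ} {x y : E n} (hx : gauge K x ≤ 1) (hy : gauge K y ≤ 1)
    (hxy : ε ≤ gauge K (x - y)) (hK : IsConvexBody K) :
    modConv K ε ≤ 1 - gauge K ((2⁻¹ : ℝ) • (x + y)) := by
  refine csInf_le ⟨0, ?_⟩ ⟨x, y, hx, hy, hxy, rfl⟩
  rintro d ⟨u, v, hu, hv, -, rfl⟩
  have h1 := gauge_add_le hK.2.1 (absorbent_nhds_zero (body_zero_nhds hK)) u v
  rw [gauge_smul_of_nonneg (by norm_num), smul_eq_mul]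
  linarith

theorem pconv_n_pos {K : Set (E n)} {p α : ℝ} (hα : 0 < α) (hK : IsPConvexBody K p α) :
    0 < n := by
  rcases Nat.eq_zero_or_pos n with rfl | h
  · exfalso
    have h2 := hK.2 2 (by norm_num) le_rfl
    have : modConv K 2 = 0 := by
      unfold modConv
      convert Real.sInf_empty
      ext d
      simp only [mem_ofPred_eq, mem_empty_iff_false, iff_false]
      rintro ⟨x, y, -, -, h, -⟩
      have e : x - y = 0 := Subsingleton.elim _ _
      rw [e, gauge_zero] at h
      linarith
    rw [this] at h2
    have : 0 < α * 2 ^ p := by positivity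
    linarith
  · exact h

theorem pconv_bound {K : Set (E n)} {p α : ℝ} (hα : 0 < α) (hK : IsPConvexBody K p α) {ε : ℝ}
    (h0 : 0 < ε) (h2 : ε ≤ 2) : α * ε ^ p ≤ ε / 2 := by
  have hn := pconv_n_pos hα hK
  obtain ⟨hK, hm⟩ := hK
  refine (hm ε h0 h2).trans ?_
  set v : E n := EuclideanSpace.single ⟨0, hn⟩ (1 : ℝ) with hv
  have hv0 : v ≠ 0 := by
    intro h
    have : ‖v‖ = 1 := by simp [hv]
    rw [h] at this; simp at this
  have hg : 0 < gauge K v := (gauge_pos (absorbent_nhds_zero (body_zero_nhds hK))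
    (hK.1.isBounded |> NormedSpace.isVonNBounded_of_isBounded ℝ)).2 hv0
  set x : E n := (gauge K v)⁻¹ • v with hx
  have hx1 : gauge K x = 1 := by
    rw [hx, gauge_smul_of_nonneg (by positivity), smul_eq_mul, inv_mul_cancel₀ hg.ne']
  have e1 : x - (1 - ε) • x = ε • x := by module
  have e2 : (2⁻¹ : ℝ) • (x + (1 - ε) • x) = (1 - ε / 2) • x := by module
  have := modConv_le (K := K) (ε := ε) (x := x) (y := (1 - ε) • x) hx1.le
    (by rw [gauge_abs_smul hK, hx1, mul_one, abs_le]; constructor <;> linarith)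
    (by rw [e1, gauge_abs_smul hK, hx1, mul_one]; exact le_abs_self _) hK
  rw [e2, gauge_abs_smul hK, hx1, mul_one, abs_of_nonneg (by linarith)] at this
  linarith

theorem pconv_one_le {K : Set (E n)} {p α : ℝ} (hα : 0 < α) (hK : IsPConvexBody K p α) :
    1 ≤ p := by
  by_contra hp
  push Not at hp
  have hq : 0 < 1 - p := by linarith
  -- pick ε with ε^(1-p) = min(..)
  set ε : ℝ := min 2 (α ^ (1 - p)⁻¹) with hε
  have h0 : 0 < ε := lt_min (by norm_num) (by positivity)
  have h1 := pconv_bound hα hK h0 (min_le_left _ _)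
  have h2 : ε ^ (1 - p) ≤ α := by
    calc ε ^ (1 - p) ≤ (α ^ (1 - p)⁻¹) ^ (1 - p) :=
          Real.rpow_le_rpow h0.le (min_le_right _ _) hq.le
      _ = α := Real.rpow_inv_rpow hα.le hq.ne'
  have h3 : ε = ε ^ (1 - p) * ε ^ p := by
    rw [← Real.rpow_add h0]; simp
  have h4 : 0 < ε ^ p := by positivity
  nlinarith

theorem diam_pos {K : Set (E n)} {p α : ℝ} (hα : 0 < α) (hK : IsPConvexBody K p α) :
    0 < Metric.diam K := by
  have hn := pconv_n_pos hα hK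
  have h0 := body_zero_nhds hK.1
  obtain ⟨r, hr, hrK⟩ := Metric.mem_nhds_iff.1 h0
  set v : E n := EuclideanSpace.single ⟨0, hn⟩ (r / 2) with hv
  have hvn : ‖v‖ = r / 2 := by simp [hv, abs_of_pos hr]
  have hvK : v ∈ K := hrK (by simp [hvn]; linarith)
  have := Metric.dist_le_diam_of_mem hK.1.1.isBounded hvK (mem_of_mem_nhds h0)
  rw [dist_zero_right, hvn] at this
  linarith

theorem norm_le_gauge {K : Set (E n)} {p α : ℝ} (hα : 0 < α) (hK : IsPConvexBody K p α)
    (z : E n) : 2 * ‖z‖ / Metric.diam K ≤ gauge K z := by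
  have hD := diam_pos hα hK
  have := le_gauge_of_subset_closedBall (x := z) (absorbent_nhds_zero (body_zero_nhds hK.1))
    (r := Metric.diam K / 2) (by linarith) ?_
  · convert this using 1
    field_simp
  · intro x hx
    have := Metric.dist_le_diam_of_mem hK.1.1.isBounded hx (body_neg_mem hK.1 hx)
    have e : dist x (-x) = 2 * ‖x‖ := by
      rw [dist_eq_norm, sub_neg_eq_add, ← two_smul ℝ, norm_smul]; simp
    rw [e] at this
    simp; linarith

theorem key_prod {K : Set (E n)} {p α : ℝ} (hα : 0 < α) (hK : IsPConvexBody K p α)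
    (hv : volume K = 1) {f : E n → ℝ} (hf : LipschitzOnWith 1 f K) (a r : ℝ) (hr : 0 < r) :
    volume {x | x ∈ K ∧ f x ≤ a} * volume {x | x ∈ K ∧ a + r ≤ f x} ≤
      ENNReal.ofReal (Real.exp (-(2 * α * n * (2 * r / Metric.diam K) ^ p))) := by
  have hD := diam_pos hα hK
  have hcl : IsClosed K := hK.1.1.isClosed
  have hA : MeasurableSet {x | x ∈ K ∧ f x ≤ a} :=
    (hf.continuousOn.preimage_isClosed_of_isClosed hcl isClosed_Iic).measurableSet
  have hB : MeasurableSet {x | x ∈ K ∧ a + r ≤ f x} :=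
    (hf.continuousOn.preimage_isClosed_of_isClosed hcl isClosed_Ici).measurableSet
  have dist_ge : ∀ x ∈ K, f x ≤ a → ∀ y ∈ K, a + r ≤ f y → r ≤ ‖x - y‖ := by
    intro x hx hxa y hy hya
    have := hf.dist_le_mul x hx y hy
    rw [Real.dist_eq, dist_eq_norm] at this
    have h2 := neg_abs_le (f x - f y)
    simp at this
    linarith
  by_cases hr1 : r ≤ Metric.diam K
  · set η := α * (2 * r / Metric.diam K) ^ p with hη
    have hε0 : 0 < 2 * r / Metric.diam K := by positivity
    have hε2 : 2 * r / Metric.diam K ≤ 2 := by rw [div_le_iff₀ hD]; linarith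
    have hmc := hK.2 _ hε0 hε2
    have hC : MeasurableSet (Real.exp (-η) • K) := (hK.1.1.smul (Real.exp (-η))).measurableSet
    have hbm := bm_set hA hB hC ?_
    · refine hbm.trans ?_
      rw [Measure.addHaar_smul_of_nonneg _ (Real.exp_pos _).le, hv, mul_one, finrank_euclideanSpace,
        Fintype.card_fin, ← Real.exp_nat_mul, ← ENNReal.ofReal_pow (Real.exp_pos _).le,
        ← Real.exp_nat_mul]
      refine ENNReal.ofReal_le_ofReal (Real.exp_le_exp.2 (le_of_eq ?_))
      rw [hη]; push_cast; ring
    · rintro x ⟨hx, hxa⟩ y ⟨hy, hya⟩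
      have h1 : 2 * r / Metric.diam K ≤ gauge K (x - y) := by
        refine le_trans ?_ (norm_le_gauge hα hK (x - y))
        have := dist_ge x hx hxa y hy hya
        gcongr
      have h2 := modConv_le (gauge_le_one_of_mem hx) (gauge_le_one_of_mem hy) h1 hK.1
      rw [mem_smul_set_iff_inv_smul_mem₀ (Real.exp_pos _).ne']
      rw [← hcl.closure_eq, ← gauge_le_one_iff_mem_closure hK.1.2.1 (body_zero_nhds hK.1),
        gauge_smul_of_nonneg (by positivity), smul_eq_mul]
      have h3 : gauge K ((2⁻¹ : ℝ) • (x + y)) ≤ Real.exp (-η) := by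
        have := Real.add_one_le_exp (-η)
        linarith
      rw [inv_mul_le_iff₀ (Real.exp_pos _)]
      simpa using h3
  · rcases eq_empty_or_nonempty {x | x ∈ K ∧ f x ≤ a} with h | ⟨x, hx, hxa⟩
    · simp [h]
    rcases eq_empty_or_nonempty {x | x ∈ K ∧ a + r ≤ f x} with h | ⟨y, hy, hya⟩
    · simp [h]
    exfalso
    have h1 := dist_ge x hx hxa y hy hya
    have h2 := Metric.dist_le_diam_of_mem hK.1.1.isBounded hx hy
    rw [dist_eq_norm] at h2
    linarith

/-- Existence of a median. -/
theorem exists_median {K : Set (E n)} (hK : IsCompact K) (hv : volume K = 1) {f : E n → ℝ}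
    (hf : ContinuousOn f K) : ∃ m : ℝ, 2⁻¹ ≤ volume {x | x ∈ K ∧ f x ≤ m} ∧
      2⁻¹ ≤ volume {x | x ∈ K ∧ m ≤ f x} := by
  have hmeas : ∀ a, MeasurableSet {x | x ∈ K ∧ f x ≤ a} := fun a =>
    (hf.preimage_isClosed_of_isClosed hK.isClosed isClosed_Iic).measurableSet
  set S : Set ℝ := {a | 2⁻¹ ≤ volume {x | x ∈ K ∧ f x ≤ a}} with hS
  obtain ⟨b, hb⟩ := (hK.image_of_continuousOn hf).bddAbove
  obtain ⟨l, hl⟩ := (hK.image_of_continuousOn hf).bddBelow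
  have hSn : S.Nonempty := by
    refine ⟨b, ?_⟩
    have : {x | x ∈ K ∧ f x ≤ b} = K := by
      ext x; simp; exact fun hx => hb (mem_image_of_mem f hx)
    rw [hS, mem_ofPred_eq, this, hv]; simp
  have hSb : BddBelow S := by
    refine ⟨l, fun a ha => ?_⟩
    by_contra hcon
    have : {x | x ∈ K ∧ f x ≤ a} = ∅ := by
      ext x; simp
      intro hx
      have := hl (mem_image_of_mem f hx)
      linarith
    rw [hS, mem_ofPred_eq, this] at ha; simp at ha
  have hup : ∀ a, sInf S < a → a ∈ S := by
    intro a ha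
    obtain ⟨s, hs, hsa⟩ := (csInf_lt_iff hSb hSn).1 ha
    exact le_trans hs (measure_mono (fun x (hx : x ∈ K ∧ f x ≤ s) => (⟨hx.1, hx.2.trans hsa.le⟩ : x ∈ K ∧ f x ≤ a)))
  have hdown : ∀ a, a < sInf S → volume {x | x ∈ K ∧ f x ≤ a} ≤ 2⁻¹ := by
    intro a ha
    by_contra hcon
    push Not at hcon
    have := csInf_le hSb (show a ∈ S from hcon.le)
    linarith
  obtain ⟨u, hu, hum, hut⟩ := exists_seq_strictAnti_tendsto (sInf S)
  obtain ⟨w, hw, hwm, hwt⟩ := exists_seq_strictMono_tendsto (sInf S)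
  refine ⟨sInf S, ?_, ?_⟩
  · have e : {x | x ∈ K ∧ f x ≤ sInf S} = ⋂ k, {x | x ∈ K ∧ f x ≤ u k} := by
      ext x
      simp only [mem_ofPred_eq, mem_iInter]
      constructor
      · exact fun h k => ⟨h.1, h.2.trans (hum k).le⟩
      · exact fun h => ⟨(h 0).1, ge_of_tendsto' hut fun k => (h k).2⟩
    rw [e]
    have hlim := tendsto_measure_iInter_atTop (μ := volume) (s := fun k => {x | x ∈ K ∧ f x ≤ u k})
      (fun k => (hmeas _).nullMeasurableSet)
      (fun i j hij x hx => ⟨hx.1, hx.2.trans (hu.antitone hij)⟩)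
      ⟨0, ne_top_of_le_ne_top (by rw [hv]; simp) (measure_mono (t := K) fun x hx => hx.1)⟩
    exact ge_of_tendsto' hlim fun k => hup _ (hum k)
  · have hU : volume (⋃ k, {x | x ∈ K ∧ f x ≤ w k}) ≤ 2⁻¹ := by
      have hlim := tendsto_measure_iUnion_atTop (μ := volume)
        (s := fun k => {x | x ∈ K ∧ f x ≤ w k})
        (fun i j hij x hx => ⟨hx.1, hx.2.trans (hw.monotone hij)⟩)
      exact le_of_tendsto' hlim fun k => hdown _ (hwm k)
    have hcov : K ⊆ (⋃ k, {x | x ∈ K ∧ f x ≤ w k}) ∪ {x | x ∈ K ∧ sInf S ≤ f x} := by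
      intro x hx
      rcases le_or_gt (sInf S) (f x) with h | h
      · exact .inr ⟨hx, h⟩
      · left
        obtain ⟨k, hk⟩ := (hwt.eventually (lt_mem_nhds h)).exists
        exact mem_iUnion.2 ⟨k, hx, hk.le⟩
    have h1 : (1 : ℝ≥0∞) ≤ 2⁻¹ + volume {x | x ∈ K ∧ sInf S ≤ f x} := by
      rw [← hv]
      exact (measure_mono hcov).trans ((measure_union_le _ _).trans (by gcongr))
    by_contra hcon
    push Not at hcon
    have : (2⁻¹ : ℝ≥0∞) + volume {x | x ∈ K ∧ sInf S ≤ f x} < 2⁻¹ + 2⁻¹ :=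
      ENNReal.add_lt_add_left (by simp) hcon
    rw [ENNReal.inv_two_add_inv_two] at this
    exact absurd h1 (not_le.2 this)

/-- One-sided deviation from the median. -/
theorem median_tail {K : Set (E n)} {p α : ℝ} (hα : 0 < α) (hK : IsPConvexBody K p α)
    (hv : volume K = 1) {f : E n → ℝ} (hf : LipschitzOnWith 1 f K) {m : ℝ}
    (hm : 2⁻¹ ≤ volume {x | x ∈ K ∧ f x ≤ m}) (r : ℝ) (hr : 0 < r) :
    volume {x | x ∈ K ∧ m + r ≤ f x} ≤
      ENNReal.ofReal (2 * Real.exp (-(2 * α * n * (2 * r / Metric.diam K) ^ p))) := by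
  have h1 := key_prod hα hK hv hf m r hr
  have h2 : 2⁻¹ * volume {x | x ∈ K ∧ m + r ≤ f x} ≤
      ENNReal.ofReal (Real.exp (-(2 * α * n * (2 * r / Metric.diam K) ^ p))) :=
    le_trans (by gcongr) h1
  rw [ENNReal.ofReal_mul (by norm_num)]
  calc volume {x | x ∈ K ∧ m + r ≤ f x} = 2 * (2⁻¹ * volume {x | x ∈ K ∧ m + r ≤ f x}) := by
        rw [← mul_assoc, ENNReal.mul_inv_cancel (by simp) (by simp), one_mul]
    _ ≤ _ := by gcongr; simp

/-- The mean exceeds the median by at most `2 e r₀`. -/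
theorem mean_sub_median {K : Set (E n)} {p α : ℝ} (hα : 0 < α) (hK : IsPConvexBody K p α)
    (hv : volume K = 1) {f : E n → ℝ} (hf : LipschitzOnWith 1 f K) {m : ℝ}
    (hm : 2⁻¹ ≤ volume {x | x ∈ K ∧ f x ≤ m}) (q : ℝ) (hq : 0 < q)
    (hqe : 2 * α * n * (2 * q / Metric.diam K) ^ p = 1) :
    (∫ y in K, f y) - m ≤ 6 * q := by
  have hp := pconv_one_le hα hK
  have hD := diam_pos hα hK
  have hint : IntegrableOn f K := hf.continuousOn.integrableOn_compact hK.1.1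
  have hKm : MeasurableSet K := hK.1.1.measurableSet
  have hprob : IsProbabilityMeasure (volume.restrict K) := ⟨by simpa using hv⟩
  have hsub : (∫ y in K, f y) - m = ∫ y in K, (f y - m) := by
    rw [integral_sub hint (integrable_const _)]; simp
  have hint2 : Integrable (fun y => f y - m) (volume.restrict K) := hint.sub (integrable_const _)
  rw [hsub]
  have hint3 : Integrable (fun y => max (f y - m) 0) (volume.restrict K) := hint2.pos_part
  refine (integral_mono hint2 hint3 fun y => le_max_left _ _).trans ?_
  have hnn : ∀ y, 0 ≤ max (f y - m) 0 := fun y => le_max_right _ _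
  rw [integral_eq_lintegral_of_nonneg_ae (.of_forall hnn)
    hint3.aestronglyMeasurable]
  refine ENNReal.toReal_le_of_le_ofReal (by positivity) ?_
  rw [lintegral_eq_lintegral_meas_le _ (.of_forall hnn)
    hint3.aestronglyMeasurable.aemeasurable]
  have hb : ∀ t ∈ Ioi (0 : ℝ), (volume.restrict K) {a | t ≤ max (f a - m) 0} ≤
      ENNReal.ofReal (2 * Real.exp 1 * Real.exp (-q⁻¹ * t)) := by
    intro t ht
    have ht0 : 0 < t := ht
    rw [Measure.restrict_apply' hKm]
    refine (measure_mono ?_).trans ((median_tail hα hK hv hf hm t ht0).trans ?_)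
    · rintro x ⟨hx, hxK⟩
      refine ⟨hxK, ?_⟩
      rcases le_max_iff.1 (show t ≤ max (f x - m) 0 from hx) with h | h <;> linarith
    · refine ENNReal.ofReal_le_ofReal ?_
      rw [mul_assoc 2 (Real.exp 1), ← Real.exp_add]
      gcongr
      have e : 2 * α * n * (2 * t / Metric.diam K) ^ p = (t / q) ^ p := by
        have : 2 * t / Metric.diam K = (2 * q / Metric.diam K) * (t / q) := by field_simp
        rw [this, Real.mul_rpow (by positivity) (by positivity), ← mul_assoc, hqe, one_mul]
      rw [e]
      have h3 : t / q - 1 ≤ (t / q) ^ p := by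
        rcases le_total (t / q) 1 with h | h
        · have : 0 ≤ (t / q) ^ p := by positivity
          linarith
        · have := Real.rpow_le_rpow_of_exponent_le h hp
          rw [Real.rpow_one] at this
          linarith
      have : q⁻¹ * t = t / q := by field_simp
      rw [neg_mul, this]
      linarith
  refine (setLIntegral_mono' measurableSet_Ioi hb).trans ?_
  have hI : IntegrableOn (fun t => Real.exp (-q⁻¹ * t)) (Ioi 0) :=
    exp_neg_integrableOn_Ioi 0 (by positivity)
  rw [← ofReal_integral_eq_lintegral_ofReal (hI.const_mul _) (.of_forall fun t => by positivity)]
  refine ENNReal.ofReal_le_ofReal ?_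
  rw [integral_const_mul, integral_exp_mul_Ioi (by simpa using hq)]
  have := Real.exp_one_lt_d9
  simp
  nlinarith

theorem p_convex_lipschitz_concentration :
    ∃ c > (0 : ℝ),
      ∀ (n : ℕ) (K : Set (E n)) (p α : ℝ), 0 < α →
        IsPConvexBody K p α → volume K = 1 →
        ∀ f : E n → ℝ, LipschitzOnWith 1 f K →
          ∀ t : ℝ, 0 < t →
            volume {x : E n | x ∈ K ∧ Metric.diam K * t ≤ |f x - ∫ y in K, f y|} ≤
              ENNReal.ofReal (4 * Real.exp (-(2 * c ^ p * α * n * t ^ p))) := by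
  refine ⟨1 / 6, by norm_num, ?_⟩
  intro n K p α hα hK hv f hf t ht
  have hp := pconv_one_le hα hK
  have hD := diam_pos hα hK
  have hn := pconv_n_pos hα hK
  have hn' : (0 : ℝ) < n := by exact_mod_cast hn
  set D := Metric.diam K with hDdef
  obtain ⟨m, hm1, hm2⟩ := exists_median hK.1.1 hv hf.continuousOn
  have hfneg : LipschitzOnWith 1 (fun x => -f x) K := by
    intro x hx y hy
    simpa [edist_neg_neg] using hf hx hy
  have hm2' : 2⁻¹ ≤ volume {x | x ∈ K ∧ -f x ≤ -m} := by simpa using hm2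
  set w : ℝ := (2 * α * n)⁻¹ ^ p⁻¹ with hw
  have hw0 : 0 < w := by positivity
  have hwp : 2 * α * n * w ^ p = 1 := by
    rw [hw, Real.rpow_inv_rpow (by positivity) (by linarith)]
    field_simp
  set q : ℝ := D * w / 2 with hq
  have hq0 : 0 < q := by positivity
  have hqe : 2 * α * n * (2 * q / D) ^ p = 1 := by
    rw [← hwp, hq]; congr 2; field_simp
  have hmm1 := mean_sub_median hα hK hv hf hm1 q hq0 hqe
  have hmm2 := mean_sub_median hα hK hv hfneg hm2' q hq0 hqe
  rw [integral_neg] at hmm2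
  set M := ∫ y in K, f y with hM
  rcases le_or_gt t (6 * w) with hcase | hcase
  · have h1 : volume {x : E n | x ∈ K ∧ D * t ≤ |f x - M|} ≤ 1 := by
      rw [← hv]; exact measure_mono fun x hx => hx.1
    refine h1.trans ?_
    rw [← ENNReal.ofReal_one]
    refine ENNReal.ofReal_le_ofReal ?_
    have h2 : 2 * (1 / 6 : ℝ) ^ p * α * n * t ^ p ≤ 1 := by
      have : (1 / 6 : ℝ) ^ p * t ^ p ≤ w ^ p := by
        rw [← Real.mul_rpow (by norm_num) ht.le]
        exact Real.rpow_le_rpow (by positivity) (by linarith) (by linarith)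
      calc 2 * (1 / 6 : ℝ) ^ p * α * n * t ^ p = 2 * α * n * ((1 / 6 : ℝ) ^ p * t ^ p) := by ring
        _ ≤ 2 * α * n * w ^ p := by gcongr
        _ = 1 := hwp
    have h3 : Real.exp (-1) ≤ Real.exp (-(2 * (1 / 6 : ℝ) ^ p * α * n * t ^ p)) :=
      Real.exp_le_exp.2 (by linarith)
    have h4 := Real.exp_neg_one_gt_d9
    linarith
  · have hr0 : 0 < D * t / 2 := by positivity
    have hqt : 6 * q ≤ D * t / 2 := by
      rw [hq]; nlinarith
    have t1 := median_tail hα hK hv hf hm1 _ hr0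
    have t2 := median_tail hα hK hv hfneg hm2' _ hr0
    have hsub : {x : E n | x ∈ K ∧ D * t ≤ |f x - M|} ⊆
        {x | x ∈ K ∧ m + D * t / 2 ≤ f x} ∪ {x | x ∈ K ∧ -m + D * t / 2 ≤ -f x} := by
      rintro x ⟨hx, hxt⟩
      rcases le_abs.1 hxt with h | h
      · left; exact ⟨hx, by linarith⟩
      · right; exact ⟨hx, by linarith⟩
    refine (measure_mono hsub).trans ((measure_union_le _ _).trans ((add_le_add t1 t2).trans ?_))
    rw [← ENNReal.ofReal_add (by positivity) (by positivity)]
    refine ENNReal.ofReal_le_ofReal ?_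
    have e : 2 * (D * t / 2) / Metric.diam K = t := by rw [← hDdef]; field_simp
    rw [e]
    have h6 : (1 / 6 : ℝ) ^ p ≤ 1 := Real.rpow_le_one (by norm_num) (by norm_num) (by linarith)
    have h7 : Real.exp (-(2 * α * n * t ^ p)) ≤ Real.exp (-(2 * (1 / 6 : ℝ) ^ p * α * n * t ^ p)) := by
      refine Real.exp_le_exp.2 (neg_le_neg ?_)
      calc 2 * (1 / 6 : ℝ) ^ p * α * n * t ^ p = (1 / 6 : ℝ) ^ p * (2 * α * n * t ^ p) := by ring
        _ ≤ 1 * (2 * α * n * t ^ p) := by gcongr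
        _ = _ := one_mul _
    linarith

end GM
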